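/- arXiv:2410.20525 — 3 statements merged into one kernel-verified Lean document; each statement's English description precedes it below -/
import Mathlib

section
/- Let G be a directed polymatroidal network. For every set S ⊆ V with 0 < vol(S) ≤ vol(V)/2, the spectral gap satisfies γ₂ · vol(S) ≤ 2 · cutval(S). (This is the easy direction of the Cheeger inequality for polymatroidal networks: γ₂ ≤ 2·Φ_G, where Φ_G is the minimum conductance cutval(S)/min{vol(S), vol(V∖S)} over nonempty proper S ⊆ V.) -/
open MeasureTheory

/-- Lovász extension of the set function `f`, with ground set `D`,
evaluated at the (nonnegative) vector `x`. -/
noncomputable def lovOn {E : Type*} (f : Set E → ℝ) (D : Set E) (x : E → ℝ) : ℝ :=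
  ∫ θ in Set.Ioi (0 : ℝ), f (D ∩ {e | θ ≤ x e})

/-- A directed polymatroidal network on vertex type `V` and edge type `E`. -/
structure PolyNet (V E : Type*) [Fintype V] [Fintype E] where
  tail : E → V
  head : E → V
  w : V → ℝ
  w_nonneg : ∀ v, 0 ≤ w v
  ρp : V → Set E → ℝ
  ρm : V → Set E → ℝ
  ρp_nonneg : ∀ v A, 0 ≤ ρp v A
  ρm_nonneg : ∀ v A, 0 ≤ ρm v A
  ρp_empty : ∀ v, ρp v ∅ = 0
  ρm_empty : ∀ v, ρm v ∅ = 0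
  ρp_mono : ∀ v A B, A ⊆ B → B ⊆ {e | tail e = v} → ρp v A ≤ ρp v B
  ρm_mono : ∀ v A B, A ⊆ B → B ⊆ {e | head e = v} → ρm v A ≤ ρm v B
  ρp_submod : ∀ v A B, A ⊆ {e | tail e = v} → B ⊆ {e | tail e = v} →
    ρp v (A ∪ B) + ρp v (A ∩ B) ≤ ρp v A + ρp v B
  ρm_submod : ∀ v A B, A ⊆ {e | head e = v} → B ⊆ {e | head e = v} →
    ρm v (A ∪ B) + ρm v (A ∩ B) ≤ ρm v A + ρm v B

namespace PolyNet

variable {V E : Type*} [Fintype V] [Fintype E] (N : PolyNet V E)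

/-- The set of edges leaving `v`. -/
def outE (v : V) : Set E := {e | N.tail e = v}

/-- The set of edges entering `v`. -/
def inE (v : V) : Set E := {e | N.head e = v}

/-- The degree of a vertex. -/
noncomputable def deg (v : V) : ℝ := N.ρp v (N.outE v) + N.ρm v (N.inE v)

/-- The volume of a set of vertices. -/
noncomputable def vol (S : Set V) : ℝ := ∑ v, S.indicator N.deg v

/-- The total weight of a set of vertices. -/
noncomputable def wsum (S : Set V) : ℝ := ∑ v, S.indicator N.w v

/-- An assignment `g` of (cut) edges to vertices is valid on `F` if every edge of `F` is
assigned to one of its endpoints. -/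
def valid (F : Set E) (g : E → V) : Prop := ∀ e ∈ F, g e = N.tail e ∨ g e = N.head e

/-- The cost of the cut `F` under the assignment `g`. -/
noncomputable def cutCost (F : Set E) (g : E → V) : ℝ :=
  ∑ v, (N.ρp v (N.outE v ∩ F ∩ {e | g e = v}) + N.ρm v (N.inE v ∩ F ∩ {e | g e = v}))

/-- The cost of the cut `F`: minimum over valid assignments. -/
noncomputable def cut (F : Set E) : ℝ :=
  sInf {c | ∃ g : E → V, N.valid F g ∧ c = N.cutCost F g}

/-- Edges from `S` to its complement. -/
def dplus (S : Set V) : Set E := {e | N.tail e ∈ S ∧ N.head e ∉ S}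

/-- Edges from the complement of `S` into `S`. -/
def dminus (S : Set V) : Set E := {e | N.tail e ∉ S ∧ N.head e ∈ S}

/-- The (directed) value of the cut induced by `S`. -/
noncomputable def cutval (S : Set V) : ℝ := min (N.cut (N.dplus S)) (N.cut (N.dminus S))

/-- The symmetric value of the cut induced by `S`. -/
noncomputable def symcutval (S : Set V) : ℝ := N.cut (N.dplus S) + N.cut (N.dminus S)

/-- The Rayleigh quotient `R⁺`. -/
noncomputable def Rp (x : V ⊕ E → ℝ) : ℝ :=
  (∑ v, (lovOn (N.ρp v) (N.outE v) (fun e => (max 0 (x (Sum.inl v) - x (Sum.inr e)))^2)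
       + lovOn (N.ρm v) (N.inE v) (fun e => (max 0 (x (Sum.inr e) - x (Sum.inl v)))^2)))
  / ∑ v, N.deg v * (x (Sum.inl v))^2

/-- The Rayleigh quotient `R⁻`. -/
noncomputable def Rm (x : V ⊕ E → ℝ) : ℝ :=
  (∑ v, (lovOn (N.ρp v) (N.outE v) (fun e => (max 0 (x (Sum.inr e) - x (Sum.inl v)))^2)
       + lovOn (N.ρm v) (N.inE v) (fun e => (max 0 (x (Sum.inl v) - x (Sum.inr e)))^2)))
  / ∑ v, N.deg v * (x (Sum.inl v))^2

/-- The Rayleigh quotient `R`. -/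
noncomputable def Ray (x : V ⊕ E → ℝ) : ℝ := min (N.Rp x) (N.Rm x)

/-- The symmetric Rayleigh quotient `R̄`. -/
noncomputable def RaySym (x : V ⊕ E → ℝ) : ℝ := N.Rp x + N.Rm x

/-- The spectral gap `γ₂` of a polymatroidal network. -/
noncomputable def gap : ℝ :=
  sInf {r | ∃ x : V ⊕ E → ℝ, (∑ v, N.deg v * x (Sum.inl v)) = 0 ∧
    (0 < ∑ v, N.deg v * (x (Sum.inl v))^2) ∧ r = N.Ray x}

end PolyNet

/-- The Lovász extension of a normalized set function agrees with it on indicator vectors. -/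
theorem lovOn_eq_of_indicator {E : Type*} (f : Set E → ℝ) (hf : f ∅ = 0) (D A : Set E)
    (x : E → ℝ) (h1 : ∀ e ∈ D, e ∈ A → x e = 1) (h0 : ∀ e ∈ D, e ∉ A → x e = 0) :
    lovOn f D x = f (D ∩ A) := by
  have key : ∀ θ ∈ Set.Ioi (0 : ℝ), f (D ∩ {e | θ ≤ x e}) =
      (Set.Ioc (0 : ℝ) 1).indicator (fun _ => f (D ∩ A)) θ := by
    intro θ hθ
    have hθ' : 0 < θ := hθ
    by_cases h : θ ≤ 1
    · rw [Set.indicator_of_mem (show θ ∈ Set.Ioc (0 : ℝ) 1 from ⟨hθ', h⟩)]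
      congr 1
      ext e
      simp only [Set.mem_inter_iff, Set.mem_ofPred_eq, and_congr_right_iff]
      intro he
      by_cases hA : e ∈ A
      · simp [hA, h1 e he hA, h]
      · simp [hA, h0 e he hA, hθ']
    · rw [Set.indicator_of_notMem (fun hm => h hm.2), ← hf]
      congr 1
      ext e
      simp only [Set.mem_inter_iff, Set.mem_ofPred_eq, Set.mem_empty_iff_false, iff_false, not_and]
      intro he hle
      by_cases hA : e ∈ A
      · exact h (h1 e he hA ▸ hle)
      · rw [h0 e he hA] at hle
        exact absurd hle (not_le.mpr hθ')
  unfold lovOn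
  rw [setIntegral_congr_fun measurableSet_Ioi key, setIntegral_indicator measurableSet_Ioc,
    Set.inter_eq_self_of_subset_right Set.Ioc_subset_Ioi_self]
  simp

theorem lovOn_nonneg {E : Type*} (f : Set E → ℝ) (hf : ∀ A, 0 ≤ f A) (D : Set E) (x : E → ℝ) :
    0 ≤ lovOn f D x :=
  integral_nonneg fun _ => hf _

namespace PolyNet

variable {V E : Type*} [Fintype V] [Fintype E] (N : PolyNet V E)

theorem deg_nonneg (v : V) : 0 ≤ N.deg v :=
  add_nonneg (N.ρp_nonneg _ _) (N.ρm_nonneg _ _)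

theorem Ray_nonneg (x : V ⊕ E → ℝ) : 0 ≤ N.Ray x := by
  have hden : 0 ≤ ∑ v, N.deg v * (x (Sum.inl v)) ^ 2 :=
    Finset.sum_nonneg fun v _ => mul_nonneg (N.deg_nonneg v) (sq_nonneg _)
  exact le_min
    (div_nonneg (Finset.sum_nonneg fun v _ => add_nonneg
      (lovOn_nonneg _ (N.ρp_nonneg v) _ _) (lovOn_nonneg _ (N.ρm_nonneg v) _ _)) hden)
    (div_nonneg (Finset.sum_nonneg fun v _ => add_nonneg
      (lovOn_nonneg _ (N.ρp_nonneg v) _ _) (lovOn_nonneg _ (N.ρm_nonneg v) _ _)) hden)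

theorem gap_nonneg : 0 ≤ N.gap :=
  Real.sInf_nonneg (by rintro r ⟨x, -, -, rfl⟩; exact N.Ray_nonneg x)

theorem gap_le_Rp (x : V ⊕ E → ℝ) (hx : ∑ v, N.deg v * x (Sum.inl v) = 0)
    (hpos : 0 < ∑ v, N.deg v * (x (Sum.inl v)) ^ 2) : N.gap ≤ N.Rp x := by
  have hle : N.gap ≤ N.Ray x :=
    csInf_le ⟨0, by rintro r ⟨y, -, -, rfl⟩; exact N.Ray_nonneg y⟩ ⟨x, hx, hpos, rfl⟩
  exact hle.trans (min_le_left _ _)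

theorem vol_add_vol_compl (T : Set V) : N.vol T + N.vol Tᶜ = N.vol Set.univ := by
  simp only [vol, ← Finset.sum_add_distrib, Set.indicator_univ]
  exact Finset.sum_congr rfl fun v _ => congrFun (Set.indicator_self_add_compl T N.deg) v

theorem dminus_eq_dplus_compl (S : Set V) : N.dminus S = N.dplus Sᶜ := by
  ext e
  simp [dminus, dplus]

open Classical in
/-- The test vector of a cut: on vertices the indicator of `T` shifted by `p`; an edge of
`δ⁺(T)` charged to its tail takes the value of its head, any other edge that of its tail. -/
noncomputable def testVec (T : Set V) (g : E → V) (p : ℝ) : V ⊕ E → ℝ :=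
  Sum.elim (fun v => T.indicator 1 v - p) fun e =>
    T.indicator 1 (if e ∈ N.dplus T ∧ g e = N.tail e then N.head e else N.tail e) - p

/-- The numerator of `R⁺` at the test vector of a cut is the cost of the cut. -/
theorem numerator_testVec (T : Set V) (g : E → V) (hg : N.valid (N.dplus T) g) (p : ℝ) :
    ∑ v, (lovOn (N.ρp v) (N.outE v)
          (fun e => (max 0 (N.testVec T g p (Sum.inl v) - N.testVec T g p (Sum.inr e))) ^ 2)
        + lovOn (N.ρm v) (N.inE v)
          (fun e => (max 0 (N.testVec T g p (Sum.inr e) - N.testVec T g p (Sum.inl v))) ^ 2))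
      = N.cutCost (N.dplus T) g := by
  refine Finset.sum_congr rfl fun v _ => ?_
  rw [lovOn_eq_of_indicator _ (N.ρp_empty v) _ (N.dplus T ∩ {e | g e = v}),
    lovOn_eq_of_indicator _ (N.ρm_empty v) _ (N.dplus T ∩ {e | g e = v}),
    Set.inter_assoc, Set.inter_assoc]
  · rintro e rfl ⟨hF, hge : g e = N.head e⟩
    have hne : N.head e ≠ N.tail e := fun h => hF.2 (h ▸ hF.1)
    simp [testVec, hge, hne, hF.1, hF.2]
  · rintro e rfl hA
    by_cases hF : e ∈ N.dplus T
    · have hge : g e = N.tail e := (hg e hF).resolve_right fun h => hA ⟨hF, h⟩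
      simp [testVec, hF, hge]
    · have hF' : N.tail e ∈ T → N.head e ∈ T := by simpa [dplus] using hF
      by_cases ht : N.tail e ∈ T
      · simp [testVec, hF, ht, hF' ht]
      · by_cases hh : N.head e ∈ T <;> simp [testVec, hF, ht, hh]
  · rintro e rfl ⟨hF, hge : g e = N.tail e⟩
    simp [testVec, hF, hge, hF.1, hF.2]
  · rintro e rfl hA
    have hc : ¬ (e ∈ N.dplus T ∧ g e = N.tail e) := hA
    simp [testVec, hc]

theorem sum_deg_mul_testVec (T : Set V) (g : E → V) (p : ℝ) :
    ∑ v, N.deg v * N.testVec T g p (Sum.inl v) = N.vol T - p * N.vol Set.univ := by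
  simp only [vol, Finset.mul_sum, ← Finset.sum_sub_distrib, Set.indicator_univ]
  refine Finset.sum_congr rfl fun v _ => ?_
  by_cases hv : v ∈ T <;> simp [testVec, hv] <;> ring

theorem sum_deg_mul_testVec_sq (T : Set V) (g : E → V) (p : ℝ) :
    ∑ v, N.deg v * (N.testVec T g p (Sum.inl v)) ^ 2
      = (1 - p) ^ 2 * N.vol T + p ^ 2 * N.vol Tᶜ := by
  simp only [vol, Finset.mul_sum, ← Finset.sum_add_distrib]
  refine Finset.sum_congr rfl fun v _ => ?_
  by_cases hv : v ∈ T <;> simp [testVec, hv] <;> ring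

theorem gap_mul_le_cut_dplus (T : Set V) (hT : 0 < N.vol T) (hTc : 0 < N.vol Tᶜ) :
    N.gap * (N.vol T * N.vol Tᶜ / N.vol Set.univ) ≤ N.cut (N.dplus T) := by
  refine le_csInf ⟨_, N.tail, fun e _ => Or.inl rfl, rfl⟩ ?_
  rintro c ⟨g, hg, rfl⟩
  have hadd := N.vol_add_vol_compl T
  have hU : 0 < N.vol Set.univ := by linarith
  have hden : ∑ v, N.deg v * (N.testVec T g (N.vol T / N.vol Set.univ) (Sum.inl v)) ^ 2
      = N.vol T * N.vol Tᶜ / N.vol Set.univ := by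
    rw [sum_deg_mul_testVec_sq]
    field_simp
    rw [← hadd]
    ring
  have hpos : 0 < N.vol T * N.vol Tᶜ / N.vol Set.univ := by positivity
  have hgap := N.gap_le_Rp (N.testVec T g (N.vol T / N.vol Set.univ))
    (by rw [sum_deg_mul_testVec]; field_simp; ring) (by rw [hden]; exact hpos)
  rwa [Rp, N.numerator_testVec T g hg, hden, le_div_iff₀ hpos] at hgap

end PolyNet

/-- Easy direction of the Cheeger inequality for directed polymatroidal networks:
for every `S ⊆ V` with `0 < vol S ≤ vol V / 2`, `γ₂ · vol S ≤ 2 · cutval S`. -/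
theorem cheeger_easy_direction {V E : Type*} [Fintype V] [Fintype E] (N : PolyNet V E)
    (S : Set V) (h0 : 0 < N.vol S) (h2 : N.vol S ≤ N.vol Set.univ / 2) :
    N.gap * N.vol S ≤ 2 * N.cutval S := by
  have hadd := N.vol_add_vol_compl S
  have hc : 0 < N.vol Sᶜ := by linarith
  have hU : 0 < N.vol Set.univ := by linarith
  have hhalf : N.vol S / 2 ≤ N.vol S * N.vol Sᶜ / N.vol Set.univ := by
    rw [le_div_iff₀ hU]
    nlinarith
  have hgap := mul_le_mul_of_nonneg_left hhalf N.gap_nonneg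
  have hp := N.gap_mul_le_cut_dplus S h0 hc
  have hm := N.gap_mul_le_cut_dplus Sᶜ hc (by rwa [compl_compl])
  rw [compl_compl, mul_comm (N.vol Sᶜ), ← N.dminus_eq_dplus_compl] at hm
  have hmin := le_min (hgap.trans hp) (hgap.trans hm)
  unfold PolyNet.cutval
  linarith
end

section
/- Let G be a directed polymatroidal network and let x ∈ ℝ≥0^{V∪E} with ∑_{v∈V} w_v x_v > 0. Then there exist sets S, S' ⊆ {v ∈ V : x_v > 0} with w(S) > 0 and w(S') > 0, and valid assignments g⁺ : δ⁺(S) → V and g⁻ : δ⁻(S') → V, such that cut(δ⁺(S), g⁺)/w(S) ≤ [∑_{v∈V}(ρ̂⁺_v(a⁺(x,v)) + ρ̂⁻_v(b⁻(x,v)))] / ∑_{v∈V} w_v x_v and cut(δ⁻(S'), g⁻)/w(S') ≤ [∑_{v∈V}(ρ̂⁺_v(b⁺(x,v)) + ρ̂⁻_v(a⁻(x,v)))] / ∑_{v∈V} w_v x_v. Moreover, g⁺ and g⁻ can be chosen so that whenever an edge (u,v) ∈ δ⁺(S) satisfies x_u = x_{(u,v)} then g⁺((u,v)) = v, and whenever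 an edge (u,v) ∈ δ⁻(S') satisfies x_v = x_{(u,v)} then g⁻((u,v)) = u. -/
open MeasureTheory

/-- A set function of a measurably varying family of subsets of a finite set is integrable on
`(0, ∞)` once the members of the family are eventually empty. -/
lemma integrableOn_setFunction {E : Type*} [Finite E] {f : Set E → ℝ} (hf : f ∅ = 0)
    {A : ℝ → Set E} (hA : ∀ e, MeasurableSet {θ | e ∈ A θ}) {y : E → ℝ}
    (hy : ∀ θ, A θ ⊆ {e | θ ≤ y e}) :
    IntegrableOn (fun θ => f (A θ)) (Set.Ioi 0) := by
  obtain ⟨M, hM⟩ := (Set.finite_range y).bddAbove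
  obtain ⟨C, hC⟩ := (Set.finite_range fun B : Set E => ‖f B‖).bddAbove
  have hmeas : Measurable fun θ => f (A θ) :=
    (measurable_of_countable f).comp
      (measurable_set_iff.2 fun e => measurableSet_setOfPred.1 (hA e))
  have hI : IntegrableOn (fun θ => f (A θ)) (Set.Ioc 0 M) :=
    Measure.integrableOn_of_bounded (M := C) (by simp) hmeas.aestronglyMeasurable
      (ae_of_all _ fun θ => hC ⟨A θ, rfl⟩)
  refine hI.of_forall_sdiff_eq_zero measurableSet_Ioi fun θ hθ => ?_
  have hlt : M < θ := by
    by_contra h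
    exact hθ.2 ⟨hθ.1, not_lt.1 h⟩
  have hempty : A θ = ∅ := Set.eq_empty_of_forall_notMem fun e he =>
    absurd (hM ⟨e, rfl⟩) (not_le.2 (hlt.trans_le (hy θ he)))
  simp only [hempty, hf]

/-- Sweeping a threshold over the elements lying above the level `a` gives the Lovász extension
of the excess over `a`. -/
lemma integral_above_eq_lovOn {E : Type*} {f : Set E → ℝ} (hf : f ∅ = 0) (D : Set E)
    (y : E → ℝ) {a : ℝ} (ha : 0 ≤ a) :
    ∫ θ in Set.Ioi (0 : ℝ), f (D ∩ {e | a < θ ∧ θ ≤ y e}) =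
      lovOn f D fun e => max 0 (y e - a) := by
  have hzero : ∀ θ ≤ a, f (D ∩ {e | a < θ ∧ θ ≤ y e}) = 0 := by
    intro θ hθ
    rw [show D ∩ {e | a < θ ∧ θ ≤ y e} = ∅ by
      ext e; simp [not_lt.2 hθ], hf]
  rw [lovOn, setIntegral_eq_integral_of_forall_compl_eq_zero (s := Set.Ioi 0)
      (fun θ hθ => hzero θ ((not_lt.1 hθ).trans ha)),
    ← integral_add_right_eq_self _ a,
    ← setIntegral_eq_integral_of_forall_compl_eq_zero (s := Set.Ioi 0)
      (fun θ hθ => hzero _ (by linarith [Set.notMem_Ioi.1 hθ]))]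
  refine setIntegral_congr_fun measurableSet_Ioi fun θ hθ => ?_
  have hθ : 0 < θ := hθ
  congr 2
  ext e
  simp only [Set.mem_ofPred_eq, le_max_iff]
  constructor
  · rintro ⟨-, h⟩
    exact Or.inr (by linarith)
  · rintro (h | h)
    · linarith
    · exact ⟨by linarith, by linarith⟩

/-- Sweeping a threshold over the elements lying below the level `a` is bounded by the Lovász
extension of the deficit from `a`. -/
lemma integral_below_le_lovOn {E : Type*} [Finite E] {f : Set E → ℝ} (hf : f ∅ = 0) {D : Set E}
    (hmono : ∀ A B, A ⊆ B → B ⊆ D → f A ≤ f B) {y : E → ℝ} (hy : ∀ e, 0 ≤ y e) (a : ℝ) :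
    ∫ θ in Set.Ioi (0 : ℝ), f (D ∩ {e | y e < θ ∧ θ ≤ a}) ≤
      lovOn f D fun e => max 0 (a - y e) := by
  have hzero : ∀ θ, (θ ≤ 0 ∨ a < θ) → f (D ∩ {e | y e < θ ∧ θ ≤ a}) = 0 := by
    intro θ hθ
    rw [show D ∩ {e | y e < θ ∧ θ ≤ a} = ∅ by
      ext e
      simp only [Set.mem_inter_iff, Set.mem_ofPred_eq, Set.mem_empty_iff_false, iff_false]
      rintro ⟨-, h1, h2⟩
      rcases hθ with h | h <;> linarith [hy e], hf]
  rw [lovOn, setIntegral_eq_integral_of_forall_compl_eq_zero (s := Set.Ioi 0)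
      (fun θ hθ => hzero θ (Or.inl (not_lt.1 hθ))),
    ← integral_sub_left_eq_self _ volume a,
    ← setIntegral_eq_integral_of_forall_compl_eq_zero (s := Set.Ici 0)
      (fun θ hθ => hzero _ (Or.inr (by linarith [Set.notMem_Ici.1 hθ]))),
    integral_Ici_eq_integral_Ioi]
  refine setIntegral_mono_on
    (integrableOn_setFunction hf (y := fun e => a - y e) (fun e => ?_) ?_)
    (integrableOn_setFunction hf (y := fun e => max 0 (a - y e)) (fun e => ?_) ?_)
    measurableSet_Ioi fun θ _ => hmono _ _ ?_ Set.inter_subset_left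
  · simp only [Set.mem_inter_iff, Set.mem_ofPred_eq]
    measurability
  · rintro θ e ⟨-, h, -⟩
    simp only [Set.mem_ofPred_eq]
    linarith
  · simp only [Set.mem_inter_iff, Set.mem_ofPred_eq]
    measurability
  · exact fun θ => Set.inter_subset_right
  · rintro e ⟨he, h, -⟩
    exact ⟨he, (le_sub_comm.1 h.le).trans (le_max_right _ _)⟩

/-- An averaging argument: if `∫ c ≤ K` and `∫ m = D > 0`, then `c / m ≤ K / D` somewhere
on any given conull set. -/
lemma exists_ratio_le_of_integral_le {α : Type*} [MeasurableSpace α] {μ : Measure α}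
    {c m : α → ℝ} (hc : Integrable c μ) (hm : Integrable m μ) (hc0 : ∀ t, 0 ≤ c t)
    (hm0 : ∀ t, 0 ≤ m t) {K D : ℝ} (hcK : ∫ t, c t ∂μ ≤ K) (hmD : ∫ t, m t ∂μ = D)
    (hD : 0 < D) {s : Set α} (hs : ∀ᵐ t ∂μ, t ∈ s) :
    ∃ t ∈ s, 0 < m t ∧ c t / m t ≤ K / D := by
  by_contra! H
  have hlt : ∀ t ∈ s, 0 < m t → 0 < c t * D - K * m t := by
    intro t hts ht
    have := H t hts ht
    rw [div_lt_div_iff₀ hD ht] at this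
    linarith
  have hnn : 0 ≤ᵐ[μ] fun t => c t * D - K * m t := by
    filter_upwards [hs] with t hts
    rcases (hm0 t).eq_or_lt with h | h
    · simp only [← h, mul_zero, sub_zero, Pi.zero_apply]
      exact mul_nonneg (hc0 t) hD.le
    · exact (hlt t hts h).le
  have hint : Integrable (fun t => c t * D - K * m t) μ := (hc.mul_const D).sub (hm.const_mul K)
  have hval : ∫ t, (c t * D - K * m t) ∂μ = 0 := by
    refine le_antisymm ?_ (integral_nonneg_of_ae hnn)
    rw [integral_sub (hc.mul_const D) (hm.const_mul K), integral_mul_const, integral_const_mul,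
      hmD, sub_nonpos]
    exact mul_le_mul_of_nonneg_right hcK hD.le
  have hm_zero : m =ᵐ[μ] 0 := by
    filter_upwards [(integral_eq_zero_iff_of_nonneg_ae hnn hint).1 hval, hs] with t ht hts
    by_contra h
    exact (hlt t hts ((hm0 t).lt_of_ne' h)).ne' ht
  rw [integral_congr_ae hm_zero] at hmD
  simp only [Pi.zero_apply, integral_zero] at hmD
  exact hD.ne hmD

namespace PolyNet

variable {V E : Type*} [Fintype V] [Fintype E] (N : PolyNet V E)

/-- The network obtained by reversing every edge. -/
def reverse : PolyNet V E where
  tail := N.head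
  head := N.tail
  w := N.w
  w_nonneg := N.w_nonneg
  ρp := N.ρm
  ρm := N.ρp
  ρp_nonneg := N.ρm_nonneg
  ρm_nonneg := N.ρp_nonneg
  ρp_empty := N.ρm_empty
  ρm_empty := N.ρp_empty
  ρp_mono := N.ρm_mono
  ρm_mono := N.ρp_mono
  ρp_submod := N.ρm_submod
  ρm_submod := N.ρp_submod

lemma reverse_dplus (S : Set V) : N.reverse.dplus S = N.dminus S :=
  Set.ext fun _ => and_comm

lemma reverse_cutCost (F : Set E) (g : E → V) : N.reverse.cutCost F g = N.cutCost F g :=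
  Finset.sum_congr rfl fun _ _ => add_comm _ _

/-- Each edge is assigned to its tail if the threshold exceeds its own value, and to its head
otherwise. -/
noncomputable def thresholdAssignment (x : V ⊕ E → ℝ) (θ : ℝ) (e : E) : V :=
  open Classical in if x (Sum.inr e) < θ then N.tail e else N.head e

/-- The cost of a threshold cut, bounded vertex by vertex. -/
lemma cutCost_threshold_le (x : V ⊕ E → ℝ) (θ : ℝ) :
    N.cutCost (N.dplus {v | θ ≤ x (Sum.inl v)}) (N.thresholdAssignment x θ) ≤
      ∑ v, (N.ρp v (N.outE v ∩ {e | x (Sum.inr e) < θ ∧ θ ≤ x (Sum.inl v)}) +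
        N.ρm v (N.inE v ∩ {e | x (Sum.inl v) < θ ∧ θ ≤ x (Sum.inr e)})) := by
  refine Finset.sum_le_sum fun v _ => add_le_add
    (N.ρp_mono v _ _ ?_ Set.inter_subset_left) (N.ρm_mono v _ _ ?_ Set.inter_subset_left)
  · rintro e ⟨⟨hv, ht, hh⟩, hg⟩
    simp only [outE, Set.mem_ofPred_eq, not_le, thresholdAssignment] at hv ht hh hg
    refine ⟨hv, ?_, hv ▸ ht⟩
    by_contra h
    rw [if_neg h] at hg
    rw [hg, ← hv] at hh
    linarith
  · rintro e ⟨⟨hv, ht, hh⟩, hg⟩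
    simp only [inE, Set.mem_ofPred_eq, not_le, thresholdAssignment] at hv ht hh hg
    refine ⟨hv, hv ▸ hh, ?_⟩
    by_contra h
    rw [if_pos (not_le.1 h)] at hg
    rw [hg, ← hv] at ht
    linarith

lemma wsum_nonneg (S : Set V) : 0 ≤ N.wsum S :=
  Finset.sum_nonneg fun v _ => Set.indicator_nonneg (fun v _ => N.w_nonneg v) v

/-- The integrability and the integral of the weight of a threshold set. -/
lemma integral_wsum_threshold {x : V → ℝ} (hx : ∀ v, 0 ≤ x v) :
    IntegrableOn (fun θ => N.wsum {v | θ ≤ x v}) (Set.Ioi 0) ∧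
      ∫ θ in Set.Ioi (0 : ℝ), N.wsum {v | θ ≤ x v} = ∑ v, N.w v * x v := by
  have hrw : ∀ v, (fun θ : ℝ => Set.indicator {v | θ ≤ x v} N.w v) =
      (Set.Iic (x v)).indicator fun _ => N.w v := by
    intro v
    ext θ
    simp only [Set.indicator_apply, Set.mem_ofPred_eq, Set.mem_Iic]
  have hint : ∀ v, IntegrableOn (fun θ : ℝ => Set.indicator {v | θ ≤ x v} N.w v)
      (Set.Ioi 0) := by
    intro v
    rw [hrw, IntegrableOn, integrable_indicator_iff measurableSet_Iic, IntegrableOn,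
      Measure.restrict_restrict measurableSet_Iic, Set.inter_comm, Set.Ioi_inter_Iic]
    exact integrableOn_const (by simp)
  refine ⟨integrable_finsetSum _ fun v _ => hint v, ?_⟩
  simp only [wsum]
  rw [integral_finsetSum _ fun v _ => hint v]
  refine Finset.sum_congr rfl fun v _ => ?_
  rw [hrw, setIntegral_indicator measurableSet_Iic, Set.Ioi_inter_Iic]
  simp [hx v, mul_comm]

/-- The line-embedding lemma for outgoing cuts. -/
lemma exists_threshold_dplus (x : V ⊕ E → ℝ) (hx : ∀ i, 0 ≤ x i)
    (hpos : 0 < ∑ v, N.w v * x (Sum.inl v)) :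
    ∃ (S : Set V) (g : E → V), S ⊆ {v | 0 < x (Sum.inl v)} ∧ 0 < N.wsum S ∧
      N.valid (N.dplus S) g ∧
      N.cutCost (N.dplus S) g / N.wsum S ≤
        (∑ v, (lovOn (N.ρp v) (N.outE v) (fun e => max 0 (x (Sum.inl v) - x (Sum.inr e)))
             + lovOn (N.ρm v) (N.inE v) (fun e => max 0 (x (Sum.inr e) - x (Sum.inl v)))))
          / ∑ v, N.w v * x (Sum.inl v) ∧
      (∀ e ∈ N.dplus S, x (Sum.inl (N.tail e)) = x (Sum.inr e) → g e = N.head e) := by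
  have hintp : ∀ v, IntegrableOn (fun θ =>
      N.ρp v (N.outE v ∩ {e | x (Sum.inr e) < θ ∧ θ ≤ x (Sum.inl v)})) (Set.Ioi 0) := by
    refine fun v => integrableOn_setFunction (N.ρp_empty v) (y := fun _ => x (Sum.inl v))
      (fun e => ?_) fun θ e he => he.2.2
    simp only [Set.mem_inter_iff, Set.mem_ofPred_eq]
    measurability
  have hintm : ∀ v, IntegrableOn (fun θ =>
      N.ρm v (N.inE v ∩ {e | x (Sum.inl v) < θ ∧ θ ≤ x (Sum.inr e)})) (Set.Ioi 0) := by
    refine fun v => integrableOn_setFunction (N.ρm_empty v) (y := fun e => x (Sum.inr e))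
      (fun e => ?_) fun θ e he => he.2.2
    simp only [Set.mem_inter_iff, Set.mem_ofPred_eq]
    measurability
  have hint : ∀ v ∈ Finset.univ, IntegrableOn (fun θ =>
      N.ρp v (N.outE v ∩ {e | x (Sum.inr e) < θ ∧ θ ≤ x (Sum.inl v)}) +
        N.ρm v (N.inE v ∩ {e | x (Sum.inl v) < θ ∧ θ ≤ x (Sum.inr e)})) (Set.Ioi 0) :=
    fun v _ => (hintp v).add (hintm v)
  obtain ⟨hw_int, hw_val⟩ := N.integral_wsum_threshold fun v => hx (Sum.inl v)
  have hcost : ∫ θ in Set.Ioi (0 : ℝ),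
      ∑ v, (N.ρp v (N.outE v ∩ {e | x (Sum.inr e) < θ ∧ θ ≤ x (Sum.inl v)}) +
        N.ρm v (N.inE v ∩ {e | x (Sum.inl v) < θ ∧ θ ≤ x (Sum.inr e)})) ≤
      ∑ v, (lovOn (N.ρp v) (N.outE v) (fun e => max 0 (x (Sum.inl v) - x (Sum.inr e)))
        + lovOn (N.ρm v) (N.inE v) (fun e => max 0 (x (Sum.inr e) - x (Sum.inl v)))) := by
    rw [integral_finsetSum _ hint]
    refine Finset.sum_le_sum fun v _ => ?_
    rw [integral_add (hintp v) (hintm v)]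
    exact add_le_add
      (integral_below_le_lovOn (N.ρp_empty v) (N.ρp_mono v) (fun e => hx (Sum.inr e)) _)
      (integral_above_eq_lovOn (N.ρm_empty v) _ (fun e => x (Sum.inr e)) (hx _)).le
  obtain ⟨θ, hθ, hwθ, hratio⟩ := exists_ratio_le_of_integral_le (s := Set.Ioi 0)
    (integrable_finsetSum _ hint) hw_int
    (fun θ => Finset.sum_nonneg fun v _ => add_nonneg (N.ρp_nonneg v _) (N.ρm_nonneg v _))
    (fun θ => N.wsum_nonneg _) hcost hw_val hpos (ae_restrict_mem measurableSet_Ioi)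
  refine ⟨{v | θ ≤ x (Sum.inl v)}, N.thresholdAssignment x θ,
    fun v hv => Set.mem_ofPred.2 (lt_of_lt_of_le hθ hv),
    hwθ, fun e _ => ?_,
    (div_le_div_of_nonneg_right (N.cutCost_threshold_le x θ) hwθ.le).trans hratio,
    fun e he htie => if_neg ?_⟩
  · unfold thresholdAssignment
    split_ifs
    · exact Or.inl rfl
    · exact Or.inr rfl
  · rw [← htie]
    exact not_lt.2 he.1

end PolyNet

/-- Line-embedding lemma (Chekuri et al.): given a nonnegative embedding `x` of
vertices and edges with `∑_v w_v x_v > 0`, there are sets `S, S'` supported on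
`{v : x_v > 0}` and valid assignments `g⁺, g⁻` whose cut-to-weight ratios are
bounded by the corresponding Lovász-extension Rayleigh-type quotients; moreover
`g⁺`, `g⁻` can be chosen to respect ties as stated. -/
theorem line_embedding_directed {V E : Type*} [Fintype V] [Fintype E] (N : PolyNet V E)
    (x : V ⊕ E → ℝ) (hx : ∀ i, 0 ≤ x i)
    (hpos : 0 < ∑ v, N.w v * x (Sum.inl v)) :
    ∃ (S S' : Set V) (gp gm : E → V),
      S ⊆ {v | 0 < x (Sum.inl v)} ∧ S' ⊆ {v | 0 < x (Sum.inl v)} ∧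
      0 < N.wsum S ∧ 0 < N.wsum S' ∧
      N.valid (N.dplus S) gp ∧ N.valid (N.dminus S') gm ∧
      N.cutCost (N.dplus S) gp / N.wsum S ≤
        (∑ v, (lovOn (N.ρp v) (N.outE v) (fun e => max 0 (x (Sum.inl v) - x (Sum.inr e)))
             + lovOn (N.ρm v) (N.inE v) (fun e => max 0 (x (Sum.inr e) - x (Sum.inl v)))))
          / ∑ v, N.w v * x (Sum.inl v) ∧
      N.cutCost (N.dminus S') gm / N.wsum S' ≤
        (∑ v, (lovOn (N.ρp v) (N.outE v) (fun e => max 0 (x (Sum.inr e) - x (Sum.inl v)))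
             + lovOn (N.ρm v) (N.inE v) (fun e => max 0 (x (Sum.inl v) - x (Sum.inr e)))))
          / ∑ v, N.w v * x (Sum.inl v) ∧
      (∀ e ∈ N.dplus S, x (Sum.inl (N.tail e)) = x (Sum.inr e) → gp e = N.head e) ∧
      (∀ e ∈ N.dminus S', x (Sum.inl (N.head e)) = x (Sum.inr e) → gm e = N.tail e) := by
  obtain ⟨S, gp, hS, hwS, hvalid, hratio, htie⟩ := N.exists_threshold_dplus x hx hpos
  obtain ⟨S', gm, hS', hwS', hvalid', hratio', htie'⟩ :=
    N.reverse.exists_threshold_dplus x hx hpos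
  rw [N.reverse_dplus] at hvalid' hratio' htie'
  rw [N.reverse_cutCost] at hratio'
  refine ⟨S, S', gp, gm, hS, hS', hwS, hwS', hvalid, fun e he => (hvalid' e he).symm, hratio, ?_,
    htie, htie'⟩
  refine hratio'.trans_eq ?_
  congr 1
  exact Finset.sum_congr rfl fun v _ => add_comm _ _
end

section
/- Let G be a directed polymatroidal network and let S ⊆ V be nonempty and proper with w(S) > 0 and w(V∖S) > 0. Then there exists a family of real numbers (u_i)_{i ∈ V∪E∪{∅}} that is feasible for the sparsest-cut SDP relaxation, i.e. it satisfies ∑_{i,j∈V} w_i w_j (u_i − u_j)² = 1 and the ℓ₂² triangle inequalities (u_i − u_j)² + (u_j − u_k)² ≥ (u_i − u_k)² for all i, j, k ∈ V∪E∪{∅}, whose objective value ∑_{v∈V}[ρ̂⁺_v((d(v,e))_{e∈δ⁺(v)}) + ρ̂⁻_v((d(e,v))_{e∈δ⁻(v)})] is at most cutval(S)/(w(S)·w(V∖S)). Consequently the optimum of the SDP relaxation is at most the sparsity Φ_G = min over nonempty proper S ⊆ V of cutval(S)/(w(S)·w(V∖S)). -/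
open MeasureTheory

/-- The directed distance induced by a family of reals indexed by
`V ∪ E ∪ {∅}` (the reference point is `none`). -/
noncomputable def ddist {V E : Type*} (u : Option (V ⊕ E) → ℝ)
    (i j : Option (V ⊕ E)) : ℝ :=
  ((u i - u j)^2 - (u none - u i)^2 + (u none - u j)^2) / 2

/-- The Lovász extension of a normalized set function at a nonnegative multiple of an indicator
vector. -/
theorem lovOn_ite {E : Type*} (f : Set E → ℝ) (hf : f ∅ = 0) (D T : Set E)
    [DecidablePred (· ∈ T)] {a : ℝ} (ha : 0 ≤ a) :
    lovOn f D (fun e => if e ∈ T then a else 0) = a * f (D ∩ T) := by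
  have hlevel : ∀ θ ∈ Set.Ioi (0 : ℝ), f (D ∩ {e | θ ≤ if e ∈ T then a else 0}) =
      (Set.Iic a).indicator (fun _ => f (D ∩ T)) θ := by
    intro θ hθ
    have hθ : 0 < θ := hθ
    by_cases h : θ ≤ a
    · rw [Set.indicator_of_mem (Set.mem_Iic.mpr h)]
      congr 2
      ext e
      by_cases he : e ∈ T <;> simp [he, h, hθ]
    · rw [Set.indicator_of_notMem (by simpa using h)]
      refine Eq.trans (congrArg f ?_) hf
      ext e
      by_cases he : e ∈ T <;> simp [he, not_le.mp h, hθ]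
  rw [lovOn, setIntegral_congr_fun measurableSet_Ioi hlevel,
    setIntegral_indicator measurableSet_Iic, Set.Ioi_inter_Iic, setIntegral_const]
  simp [ha]

open scoped Classical in
/-- The directed distance of a two-valued family, in terms of the side `P` of the reference
point. -/
theorem ddist_ite {V E : Type*} (P : Set (Option (V ⊕ E))) (hP : none ∈ P) (c : ℝ)
    (i j : Option (V ⊕ E)) :
    ddist (fun i => if i ∈ P then c else 0) i j = if i ∈ P ∧ j ∉ P then c ^ 2 else 0 := by
  by_cases hi : i ∈ P <;> by_cases hj : j ∈ P <;> simp [ddist, hP, hi, hj]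

namespace PolyNet

variable {V E : Type*} [Fintype V] [Fintype E] (N : PolyNet V E)

theorem cutCost_nonneg (F : Set E) (g : E → V) : 0 ≤ N.cutCost F g :=
  Finset.sum_nonneg fun _ _ => add_nonneg (N.ρp_nonneg _ _) (N.ρm_nonneg _ _)

/-- The minimum defining `cut F` is attained. -/
theorem exists_valid_cutCost_eq_cut (F : Set E) :
    ∃ g : E → V, N.valid F g ∧ N.cut F = N.cutCost F g := by
  have hfin : {c | ∃ g : E → V, N.valid F g ∧ c = N.cutCost F g}.Finite :=
    (Set.finite_range (N.cutCost F)).subset (by rintro c ⟨g, -, rfl⟩; exact ⟨g, rfl⟩)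
  have hne : {c | ∃ g : E → V, N.valid F g ∧ c = N.cutCost F g}.Nonempty :=
    ⟨_, N.tail, fun _ _ => Or.inl rfl, rfl⟩
  exact hne.csInf_mem hfin

open scoped Classical in
theorem sum_sum_weight_ite (A : Set V) (c : ℝ) :
    ∑ i, ∑ j, N.w i * N.w j * ((if i ∈ A then c else 0) - (if j ∈ A then c else 0)) ^ 2 =
      2 * (N.wsum A * N.wsum Aᶜ) * c ^ 2 := by
  have hterm : ∀ i j, N.w i * N.w j *
      ((if i ∈ A then c else 0) - (if j ∈ A then c else 0)) ^ 2 =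
      (A.indicator N.w i * Aᶜ.indicator N.w j + Aᶜ.indicator N.w i * A.indicator N.w j)
        * c ^ 2 := by
    intro i j
    by_cases hi : i ∈ A <;> by_cases hj : j ∈ A <;> simp [hi, hj]
  simp_rw [hterm, ← Finset.sum_mul, Finset.sum_add_distrib, ← Finset.sum_mul_sum, wsum]
  ring

/-- The edges placed on the side of the tail set `A`, when the cut `dplus A` is assigned by
`g`. -/
def edgeSide (A : Set V) (g : E → V) : Set E :=
  {e | N.tail e ∈ A ∧ (N.head e ∈ A ∨ g e ≠ N.tail e)}

/-- The side of the reference point in the two-valued embedding of `A` and `g`. -/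
def side (A : Set V) (g : E → V) : Set (Option (V ⊕ E)) :=
  {i | ∀ x, i = some x → Sum.elim (· ∈ A) (· ∈ N.edgeSide A g) x}

theorem none_mem_side (A : Set V) (g : E → V) : none ∈ N.side A g := by
  simp [side]

theorem vertex_mem_side {A : Set V} {g : E → V} {v : V} :
    some (Sum.inl v) ∈ N.side A g ↔ v ∈ A := by
  simp [side]

theorem edge_mem_side {A : Set V} {g : E → V} {e : E} :
    some (Sum.inr e) ∈ N.side A g ↔ e ∈ N.edgeSide A g := by
  simp [side]

open scoped Classical in
/-- The SDP objective of the two-valued embedding is at most the scaled cost of the assignment. -/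
theorem objective_side_le (A : Set V) (g : E → V) (hg : N.valid (N.dplus A) g) (c : ℝ) :
    ∑ v, (lovOn (N.ρp v) (N.outE v) (fun e => ddist
            (fun i => if i ∈ N.side A g then c else 0) (some (Sum.inl v)) (some (Sum.inr e)))
        + lovOn (N.ρm v) (N.inE v) (fun e => ddist
            (fun i => if i ∈ N.side A g then c else 0) (some (Sum.inr e)) (some (Sum.inl v))))
      ≤ c ^ 2 * N.cutCost (N.dplus A) g := by
  rw [cutCost, Finset.mul_sum]
  refine Finset.sum_le_sum fun v _ => ?_
  simp_rw [ddist_ite _ (N.none_mem_side A g), vertex_mem_side, edge_mem_side, mul_add]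
  refine add_le_add ?_ ?_
  · refine (lovOn_ite (N.ρp v) (N.ρp_empty v) (N.outE v)
      {e | v ∈ A ∧ e ∉ N.edgeSide A g} (sq_nonneg c)).trans_le ?_
    refine mul_le_mul_of_nonneg_left (N.ρp_mono _ _ _ ?_ fun e he => he.1.1) (sq_nonneg c)
    rintro e ⟨rfl, hv, he⟩
    simp only [edgeSide, Set.mem_ofPred_eq, hv, true_and, not_or, not_not] at he
    exact ⟨⟨rfl, hv, he.1⟩, he.2⟩
  · refine (lovOn_ite (N.ρm v) (N.ρm_empty v) (N.inE v)
      {e | e ∈ N.edgeSide A g ∧ v ∉ A} (sq_nonneg c)).trans_le ?_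
    refine mul_le_mul_of_nonneg_left (N.ρm_mono _ _ _ ?_ fun e he => he.1.1) (sq_nonneg c)
    rintro e ⟨rfl, he, hv⟩
    have hF : e ∈ N.dplus A := ⟨he.1, hv⟩
    exact ⟨⟨rfl, hF⟩, (hg e hF).resolve_left (he.2.resolve_left hv)⟩

/-- A feasible SDP solution whose objective is at most the sparsity of the cut `dplus A`. -/
theorem exists_feasible_objective_le (A : Set V) (hA : 0 < N.wsum A * N.wsum Aᶜ) :
    ∃ u : Option (V ⊕ E) → ℝ,
      (∑ i, ∑ j, N.w i * N.w j *
        (u (some (Sum.inl i)) - u (some (Sum.inl j)))^2) = 1 ∧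
      (∀ i j k : Option (V ⊕ E), (u i - u k)^2 ≤ (u i - u j)^2 + (u j - u k)^2) ∧
      (∑ v, (lovOn (N.ρp v) (N.outE v)
                (fun e => ddist u (some (Sum.inl v)) (some (Sum.inr e)))
           + lovOn (N.ρm v) (N.inE v)
                (fun e => ddist u (some (Sum.inr e)) (some (Sum.inl v)))))
        ≤ N.cut (N.dplus A) / (N.wsum A * N.wsum Aᶜ) := by
  classical
  obtain ⟨g, hg, hcut⟩ := N.exists_valid_cutCost_eq_cut (N.dplus A)
  set W := N.wsum A * N.wsum Aᶜ
  have hc : √(1 / (2 * W)) ^ 2 = 1 / (2 * W) := Real.sq_sqrt (by positivity)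
  refine ⟨fun i => if i ∈ N.side A g then √(1 / (2 * W)) else 0, ?_, ?_, ?_⟩
  · simp_rw [vertex_mem_side]
    rw [sum_sum_weight_ite, hc]
    change 2 * W * (1 / (2 * W)) = 1
    field_simp
  · intro i j k
    by_cases hi : i ∈ N.side A g <;> by_cases hj : j ∈ N.side A g <;>
      by_cases hk : k ∈ N.side A g <;> simp [hi, hj, hk]
  · refine (N.objective_side_le A g hg _).trans ?_
    rw [hc, hcut, one_div_mul_eq_div]
    exact div_le_div_of_nonneg_left (N.cutCost_nonneg _ _) hA (by linarith)

end PolyNet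

/-- The sparsest-cut SDP is a relaxation: for any nonempty proper `S ⊆ V` with
positive weight on both sides, there is a feasible solution of the SDP (unit
normalization and `ℓ₂²` triangle inequalities) whose objective is at most
`cutval(S)/(w(S)·w(V∖S))`. -/
theorem sdp_le_sparsity {V E : Type*} [Fintype V] [Fintype E] (N : PolyNet V E)
    (S : Set V) (hne : S.Nonempty) (hpr : S ≠ Set.univ)
    (hS : 0 < N.wsum S) (hS' : 0 < N.wsum (Set.univ \ S)) :
    ∃ u : Option (V ⊕ E) → ℝ,
      (∑ i, ∑ j, N.w i * N.w j *
        (u (some (Sum.inl i)) - u (some (Sum.inl j)))^2) = 1 ∧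
      (∀ i j k : Option (V ⊕ E), (u i - u k)^2 ≤ (u i - u j)^2 + (u j - u k)^2) ∧
      (∑ v, (lovOn (N.ρp v) (N.outE v)
                (fun e => ddist u (some (Sum.inl v)) (some (Sum.inr e)))
           + lovOn (N.ρm v) (N.inE v)
                (fun e => ddist u (some (Sum.inr e)) (some (Sum.inl v)))))
        ≤ N.cutval S / (N.wsum S * N.wsum (Set.univ \ S)) := by
  have hW := mul_pos hS hS'
  rw [← Set.compl_eq_univ_sdiff] at hW ⊢
  rw [PolyNet.cutval, N.dminus_eq_dplus_compl]
  rcases min_choice (N.cut (N.dplus S)) (N.cut (N.dplus Sᶜ)) with h | h <;> rw [h]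
  · exact N.exists_feasible_objective_le S hW
  · have hcompl := N.exists_feasible_objective_le Sᶜ
    rw [compl_compl, mul_comm] at hcompl
    exact hcompl hW
end
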